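/- Let Γ be a connected core multigraph and γ ⊆ Γ a core subgraph. Then ψ(Γ) = ψ(Γ//γ)·ψ(γ) + ψ_{Γ,γ}, where the remainder ψ_{Γ,γ} := ψ(Γ) − ψ(Γ//γ)·ψ(γ) has the property that every one of its monomials has total degree in the variables {A_e : e ∈ γ} strictly greater than h1(γ), the degree of ψ(γ). -/

import Mathlib

open scoped Classical

/-- A multigraph: finite sets of vertices and edges, where each edge is
assigned an unordered pair of (possibly equal) endpoints. -/
structure Multigraph where
  V : Type
  E : Type
  finV : Finite V
  finE : Finite E
  ends : E → Sym2 V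

attribute [instance] Multigraph.finV Multigraph.finE

namespace Multigraph

variable (G : Multigraph)

/-- `v` and `w` are joined by some edge belonging to `μ`. -/
def Step (μ : Set G.E) (v w : G.V) : Prop :=
  ∃ e ∈ μ, G.ends e = s(v, w)

/-- Connectivity with respect to the edge set `μ`, as a setoid on all vertices. -/
def connSetoid (μ : Set G.E) : Setoid G.V :=
  Relation.EqvGen.setoid (G.Step μ)

/-- The number of connected components of the spanning subgraph `(V(G), μ)`. -/
noncomputable def h0 (μ : Set G.E) : ℕ :=
  Nat.card (Quotient (G.connSetoid μ))

/-- The first Betti number `h1 = |E| − |V| + h0` of the subgraph with edge set `μ`.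
(Isolated vertices contribute equally to `|V|` and to `h0`, so this agrees with
the first Betti number of the subgraph whose vertices are the endpoints of the
edges in `μ`.) -/
noncomputable def h1 (μ : Set G.E) : ℤ :=
  (Nat.card μ : ℤ) - (Nat.card G.V : ℤ) + (G.h0 μ : ℤ)

/-- A subgraph (identified with its edge set) is core (1PI): removing any one of
its edges lowers `h1`. -/
def IsCore (μ : Set G.E) : Prop :=
  ∀ e ∈ μ, G.h1 (μ \ {e}) < G.h1 μ

/-- The multigraph is connected. -/
def Connected : Prop := G.h0 Set.univ = 1

/-- The contraction `Γ//γ`: each connected component of `γ` is contracted to a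
single vertex and the edges of `γ` are deleted. -/
def contract (γ : Set G.E) : Multigraph where
  V := Quotient (G.connSetoid γ)
  E := {e : G.E // e ∉ γ}
  finV := Quotient.finite _
  finE := Subtype.finite
  ends e := (G.ends e.1).map (Quotient.mk (G.connSetoid γ))

/-- The subgraph with edge set `γ`, as a multigraph in its own right. -/
def restrict (γ : Set G.E) : Multigraph where
  V := G.V
  E := γ
  finV := G.finV
  finE := Subtype.finite
  ends e := G.ends e.1

/-- `F` is a spanning forest: it is acyclic and consists of one spanning tree of
each connected component (equivalently, it induces the same connectivity
relation as the full edge set). -/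
def IsSpanningForest (F : Set G.E) : Prop :=
  G.h1 F = 0 ∧ G.connSetoid F = G.connSetoid Set.univ

/-- The first Kirchhoff–Symanzik (graph) polynomial
`ψ(Γ) = Σ_F Π_{e ∉ F} A_e`, the sum over spanning forests. -/
noncomputable def kirchhoff : MvPolynomial G.E ℤ :=
  ∑ᶠ F ∈ {F : Set G.E | G.IsSpanningForest F}, ∏ᶠ e ∈ Fᶜ, MvPolynomial.X e

/-- Euclidean dot product on `ℝ^D`. -/
noncomputable def dot {D : ℕ} (x y : Fin D → ℝ) : ℝ := ∑ i, x i * y i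

/-- The total momentum entering the connected component `c` of `(V(G), F)`. -/
noncomputable def momentumOf {D : ℕ} (q : G.V → Fin D → ℝ) (F : Set G.E)
    (c : Quotient (G.connSetoid F)) : Fin D → ℝ :=
  ∑ᶠ v ∈ {v : G.V | Quotient.mk (G.connSetoid F) v = c}, q v

/-- The second Kirchhoff–Symanzik polynomial
`φ(Γ) = Σ_{(T₁,T₂)} (Q(T₁)·Q(T₂)) Π_{e ∉ T₁∪T₂} A_e`, the sum over spanning
2-forests, i.e. acyclic edge sets `F` with exactly two connected components
`T₁, T₂` (jointly covering all vertices); `Q(T_i)` is the sum of the momenta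
over the vertices of `T_i`, and `Q(T₁)·Q(T₂)` is computed symmetrically via
`Q(T₁)·Q(T₂) = ((Q(T₁)+Q(T₂))² − Q(T₁)² − Q(T₂)²)/2`. -/
noncomputable def symanzik2 (D : ℕ) (q : G.V → Fin D → ℝ) : MvPolynomial G.E ℝ :=
  ∑ᶠ F ∈ {F : Set G.E | G.h1 F = 0 ∧ G.h0 F = 2},
    MvPolynomial.C
      ((dot (∑ᶠ v, q v) (∑ᶠ v, q v) -
          ∑ᶠ c : Quotient (G.connSetoid F), dot (G.momentumOf q F c) (G.momentumOf q F c)) / 2) *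
      ∏ᶠ e ∈ Fᶜ, MvPolynomial.X e

/-- External momenta pass to the contraction `Γ//γ` by assigning to each vertex
(i.e. each connected component of `γ`, or untouched vertex) the sum of the
momenta of the vertices identified to it. -/
noncomputable def contractMomenta (γ : Set G.E) {D : ℕ} (q : G.V → Fin D → ℝ) :
    (G.contract γ).V → Fin D → ℝ :=
  fun c => ∑ᶠ v ∈ {v : G.V | Quotient.mk (G.connSetoid γ) v = c}, q v

/-- A flag of core subgraphs of the subgraph `γ`: a chain (under inclusion) of
nonempty core subgraphs of `γ`, having `γ` itself as its largest member.  We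
encode a flag as its set of members. -/
def IsCoreFlagIn (γ : Set G.E) (F : Set (Set G.E)) : Prop :=
  γ ∈ F ∧ ∅ ∉ F ∧ (∀ δ ∈ F, δ ⊆ γ ∧ G.IsCore δ) ∧ IsChain (· ⊆ ·) F

/-- A maximal flag of core subgraphs of `γ`: one admitting no refinement. -/
def IsMaximalCoreFlagIn (γ : Set G.E) (F : Set (Set G.E)) : Prop :=
  G.IsCoreFlagIn γ F ∧ ∀ F' : Set (Set G.E), G.IsCoreFlagIn γ F' → F ⊆ F' → F' = F

/-- A flag of core subgraphs of `Γ`. -/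
def IsCoreFlag (F : Set (Set G.E)) : Prop := G.IsCoreFlagIn Set.univ F

/-- A maximal flag of core subgraphs of `Γ`. -/
def IsMaximalCoreFlag (F : Set (Set G.E)) : Prop := G.IsMaximalCoreFlagIn Set.univ F

end Multigraph

namespace Multigraph

variable (G : Multigraph)

theorem connSetoid_rel_of_ends {μ : Set G.E} {e : G.E} (he : e ∈ μ) {v w : G.V}
    (h : G.ends e = s(v, w)) : G.connSetoid μ v w :=
  Relation.EqvGen.rel _ _ ⟨e, he, h⟩

theorem connSetoid_le_iff {μ : Set G.E} {s : Setoid G.V} :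
    G.connSetoid μ ≤ s ↔ ∀ e ∈ μ, ∀ v w, G.ends e = s(v, w) → s v w := by
  constructor
  · intro h e he v w hvw
    exact h (G.connSetoid_rel_of_ends he hvw)
  · intro h
    exact Setoid.eqvGen_le fun v w ⟨e, he, hvw⟩ => h e he v w hvw

theorem connSetoid_mono {μ ν : Set G.E} (h : μ ⊆ ν) : G.connSetoid μ ≤ G.connSetoid ν :=
  G.connSetoid_le_iff.2 fun _ he _ _ hvw => G.connSetoid_rel_of_ends (h he) hvw

theorem connSetoid_union (μ ν : Set G.E) :
    G.connSetoid (μ ∪ ν) = G.connSetoid μ ⊔ G.connSetoid ν := by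
  apply le_antisymm
  · rw [connSetoid_le_iff]
    rintro e (he | he) v w hvw
    · exact (le_sup_left : G.connSetoid μ ≤ _) (G.connSetoid_rel_of_ends he hvw)
    · exact (le_sup_right : G.connSetoid ν ≤ _) (G.connSetoid_rel_of_ends he hvw)
  · exact sup_le (G.connSetoid_mono Set.subset_union_left)
      (G.connSetoid_mono Set.subset_union_right)

theorem connSetoid_eq_of_subset_of_h0_le {μ ν : Set G.E} (h : μ ⊆ ν) (h' : G.h0 μ ≤ G.h0 ν) :
    G.connSetoid μ = G.connSetoid ν := by
  refine le_antisymm (G.connSetoid_mono h) fun {v w} hvw => ?_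
  have hsurj : Function.Surjective
      (Quotient.map' (s₁ := G.connSetoid μ) (s₂ := G.connSetoid ν) id
        fun _ _ hab => G.connSetoid_mono h hab) := by
    rintro ⟨v⟩
    exact ⟨Quotient.mk _ v, rfl⟩
  have hbij := hsurj.bijective_of_nat_card_le h'
  exact Quotient.exact (hbij.1 (a₁ := Quotient.mk _ v) (a₂ := Quotient.mk _ w)
    (Quotient.sound hvw))

theorem h0_le_h0_insert_add_one (μ : Set G.E) (e : G.E) :
    G.h0 μ ≤ G.h0 (insert e μ) + 1 := by
  obtain ⟨u, v, huv⟩ : ∃ u v, G.ends e = s(u, v) := by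
    induction h : G.ends e with
    | _ u v => exact ⟨u, v, rfl⟩
  let q : G.V → Quotient (G.connSetoid μ) := Quotient.mk _
  let f : G.V → Quotient (G.connSetoid μ) := fun a => if q a = q v then q u else q a
  have hle : G.connSetoid (insert e μ) ≤ Setoid.ker f := by
    rw [connSetoid_le_iff]
    rintro e' (rfl | he') a b hab
    · rw [huv, Sym2.eq_iff] at hab
      rw [Setoid.ker_def]
      rcases hab with ⟨rfl, rfl⟩ | ⟨rfl, rfl⟩ <;> simp [f]
    · have : q a = q b := Quotient.sound (G.connSetoid_rel_of_ends he' hab)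
      simp [Setoid.ker_def, f, this]
  let p : Quotient (G.connSetoid μ) → Quotient (G.connSetoid (insert e μ)) :=
    Quotient.map' id fun _ _ hab => G.connSetoid_mono (Set.subset_insert e μ) hab
  have hinj : Function.Injective
      (fun c => if c = q v then none else some (p c) :
        _ → Option (Quotient (G.connSetoid (insert e μ)))) := by
    rintro ⟨a⟩ ⟨b⟩ hab
    change (if q a = q v then none else some (p (q a))) =
      (if q b = q v then none else some (p (q b))) at hab
    change q a = q b
    split_ifs at hab with ha hb hb
    · rw [ha, hb]
    · have hrel : G.connSetoid (insert e μ) a b := Quotient.exact (Option.some.inj hab)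
      have := hle hrel
      simpa [Setoid.ker_def, f, ha, hb] using this
  have := Nat.card_le_card_of_injective _ hinj
  rwa [Finite.card_option] at this

theorem h0_le_h0_union_add_ncard (μ ν : Set G.E) : G.h0 μ ≤ G.h0 (μ ∪ ν) + ν.ncard := by
  induction ν, Set.toFinite ν using Set.Finite.induction_on with
  | empty => simp
  | @insert e s he hs ih =>
    rw [Set.ncard_insert_of_notMem he hs, Set.union_insert]
    have := G.h0_le_h0_insert_add_one (μ ∪ s) e
    omega

theorem h1_eq (μ : Set G.E) : G.h1 μ = (μ.ncard : ℤ) - Nat.card G.V + G.h0 μ := rfl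

theorem h1_mono {μ ν : Set G.E} (h : μ ⊆ ν) : G.h1 μ ≤ G.h1 ν := by
  have h1 := G.h0_le_h0_union_add_ncard μ (ν \ μ)
  rw [Set.union_sdiff_cancel h] at h1
  have h2 := Set.ncard_sdiff_add_ncard_of_subset h
  rw [h1_eq, h1_eq]
  omega

theorem connSetoid_empty : G.connSetoid ∅ = ⊥ :=
  le_bot_iff.1 (G.connSetoid_le_iff.2 fun _ he => he.elim)

theorem h1_empty : G.h1 ∅ = 0 := by
  have : Function.Bijective (Quotient.mk (G.connSetoid ∅)) := by
    refine ⟨fun a b hab => ?_, Quotient.mk_surjective⟩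
    have := Quotient.exact hab
    change G.connSetoid ∅ a b at this
    rwa [connSetoid_empty] at this
  rw [h1_eq, h0, ← Nat.card_eq_of_bijective _ this]
  simp

theorem h1_nonneg (μ : Set G.E) : 0 ≤ G.h1 μ :=
  G.h1_empty ▸ G.h1_mono (Set.empty_subset μ)

/-- The edges of a contraction, as edges of the original multigraph. -/
def contractEdge (γ : Set G.E) (e : (G.contract γ).E) : G.E := e.1

/-- The edges of a subgraph, as edges of the ambient multigraph. -/
def restrictEdge (γ : Set G.E) (e : (G.restrict γ).E) : G.E := e.1

theorem contractEdge_injective (γ : Set G.E) : Function.Injective (G.contractEdge γ) :=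
  Subtype.val_injective

theorem restrictEdge_injective (γ : Set G.E) : Function.Injective (G.restrictEdge γ) :=
  Subtype.val_injective

theorem range_contractEdge (γ : Set G.E) : Set.range (G.contractEdge γ) = γᶜ :=
  Subtype.range_val

theorem range_restrictEdge (γ : Set G.E) : Set.range (G.restrictEdge γ) = γ :=
  Subtype.range_val

theorem contractEdge_notMem (γ : Set G.E) (e : (G.contract γ).E) : G.contractEdge γ e ∉ γ :=
  e.2

theorem restrictEdge_mem (γ : Set G.E) (e : (G.restrict γ).E) : G.restrictEdge γ e ∈ γ :=
  e.2

theorem disjoint_image_contractEdge (γ : Set G.E) (μ : Set (G.contract γ).E) :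
    Disjoint (G.contractEdge γ '' μ) γ := by
  refine Set.disjoint_left.2 ?_
  rintro _ ⟨e, -, rfl⟩
  exact G.contractEdge_notMem γ e

theorem image_restrictEdge_subset (γ : Set G.E) (ν : Set (G.restrict γ).E) :
    G.restrictEdge γ '' ν ⊆ γ := by
  rintro _ ⟨e, -, rfl⟩
  exact G.restrictEdge_mem γ e

theorem connSetoid_restrict (γ : Set G.E) (μ : Set (G.restrict γ).E) :
    (G.restrict γ).connSetoid μ = G.connSetoid (G.restrictEdge γ '' μ) := by
  apply le_antisymm
  · refine (G.restrict γ).connSetoid_le_iff.2 fun e he v w hvw => ?_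
    exact G.connSetoid_rel_of_ends (Set.mem_image_of_mem _ he) hvw
  · refine G.connSetoid_le_iff.2 ?_
    rintro _ ⟨e, he, rfl⟩ v w hvw
    exact (G.restrict γ).connSetoid_rel_of_ends he hvw

theorem h1_restrict (γ : Set G.E) (μ : Set (G.restrict γ).E) :
    (G.restrict γ).h1 μ = G.h1 (G.restrictEdge γ '' μ) := by
  rw [h1_eq, h1_eq, h0, connSetoid_restrict,
    Set.ncard_image_of_injective _ (G.restrictEdge_injective γ)]
  rfl

/-- The projection of the vertices of `G` to those of the contraction. -/
def contractVertex (γ : Set G.E) (v : G.V) : (G.contract γ).V := Quotient.mk (G.connSetoid γ) v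

theorem contractVertex_surjective (γ : Set G.E) : Function.Surjective (G.contractVertex γ) :=
  Quotient.mk_surjective

theorem contractVertex_eq_iff (γ : Set G.E) {v w : G.V} :
    G.contractVertex γ v = G.contractVertex γ w ↔ G.connSetoid γ v w :=
  Quotient.eq

theorem contract_ends (γ : Set G.E) (e : (G.contract γ).E) :
    (G.contract γ).ends e = (G.ends (G.contractEdge γ e)).map (G.contractVertex γ) := rfl

theorem comap_connSetoid_contract (γ : Set G.E) (μ : Set (G.contract γ).E) :
    ((G.contract γ).connSetoid μ).comap (G.contractVertex γ) =
      G.connSetoid (G.contractEdge γ '' μ ∪ γ) := by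
  apply le_antisymm
  · let out : (G.contract γ).V → G.V := Function.surjInv (G.contractVertex_surjective γ)
    have hout (v : G.V) : G.connSetoid (G.contractEdge γ '' μ ∪ γ)
        (out (G.contractVertex γ v)) v :=
      G.connSetoid_mono Set.subset_union_right
        ((G.contractVertex_eq_iff γ).1 (Function.surjInv_eq _ _))
    have hle : (G.contract γ).connSetoid μ ≤
        (G.connSetoid (G.contractEdge γ '' μ ∪ γ)).comap out := by
      rw [connSetoid_le_iff]
      intro e he x y hxy
      obtain ⟨u, v, huv⟩ : ∃ u v, G.ends (G.contractEdge γ e) = s(u, v) := by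
        induction h : G.ends (G.contractEdge γ e) with
        | _ u v => exact ⟨u, v, rfl⟩
      have hrel : G.connSetoid (G.contractEdge γ '' μ ∪ γ) u v :=
        G.connSetoid_rel_of_ends (Or.inl (Set.mem_image_of_mem _ he)) huv
      have hrel' := Setoid.trans' _ (Setoid.trans' _ (hout u) hrel) (Setoid.symm' _ (hout v))
      rw [contract_ends, huv, Sym2.map_mk, Sym2.eq_iff] at hxy
      rcases hxy with ⟨rfl, rfl⟩ | ⟨rfl, rfl⟩
      · exact hrel'
      · exact Setoid.symm' _ hrel'
    intro v w hvw
    exact Setoid.trans' _ (Setoid.trans' _ (Setoid.symm' _ (hout v)) (hle hvw)) (hout w)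
  · rw [connSetoid_le_iff]
    rintro e (⟨e, he, rfl⟩ | he) v w hvw
    · refine (G.contract γ).connSetoid_rel_of_ends he ?_
      rw [contract_ends, hvw, Sym2.map_mk]
    · rw [Setoid.comap_rel, (G.contractVertex_eq_iff γ).2 (G.connSetoid_rel_of_ends he hvw)]

theorem h0_contract (γ : Set G.E) (μ : Set (G.contract γ).E) :
    (G.contract γ).h0 μ = G.h0 (G.contractEdge γ '' μ ∪ γ) := by
  symm
  have hiff (v w : G.V) : G.connSetoid (G.contractEdge γ '' μ ∪ γ) v w ↔
      (G.contract γ).connSetoid μ (G.contractVertex γ v) (G.contractVertex γ w) := by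
    rw [← comap_connSetoid_contract, Setoid.comap_rel]
  refine Nat.card_eq_of_bijective
    (Quotient.map' (s₁ := G.connSetoid (G.contractEdge γ '' μ ∪ γ))
      (s₂ := (G.contract γ).connSetoid μ) (G.contractVertex γ)
      fun v w h => (hiff v w).1 h) ⟨?_, ?_⟩
  · rintro ⟨v⟩ ⟨w⟩ h
    exact Quotient.sound ((hiff v w).2 (Quotient.exact h))
  · rintro ⟨x⟩
    obtain ⟨v, rfl⟩ := G.contractVertex_surjective γ x
    exact ⟨Quotient.mk _ v, rfl⟩

theorem h1_contract_add_h1 (γ : Set G.E) (μ : Set (G.contract γ).E) :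
    (G.contract γ).h1 μ + G.h1 γ = G.h1 (G.contractEdge γ '' μ ∪ γ) := by
  have hdisj := G.disjoint_image_contractEdge γ μ
  have hV : Nat.card (G.contract γ).V = G.h0 γ := rfl
  rw [h1_eq, h1_eq, h1_eq, h0_contract, Set.ncard_union_eq hdisj,
    Set.ncard_image_of_injective _ (G.contractEdge_injective γ), hV]
  push_cast
  ring

theorem isSpanningForest_restrict_iff (γ : Set G.E) (μ : Set (G.restrict γ).E) :
    (G.restrict γ).IsSpanningForest μ ↔
      G.h1 (G.restrictEdge γ '' μ) = 0 ∧
        G.connSetoid (G.restrictEdge γ '' μ) = G.connSetoid γ := by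
  rw [IsSpanningForest, h1_restrict, connSetoid_restrict, connSetoid_restrict, Set.image_univ,
    range_restrictEdge]
  rfl

theorem connSetoid_contract_eq_iff (γ : Set G.E) (μ ν : Set (G.contract γ).E) :
    (G.contract γ).connSetoid μ = (G.contract γ).connSetoid ν ↔
      G.connSetoid (G.contractEdge γ '' μ ∪ γ) = G.connSetoid (G.contractEdge γ '' ν ∪ γ) := by
  rw [← comap_connSetoid_contract, ← comap_connSetoid_contract]
  refine ⟨fun h => by rw [h], fun h => ?_⟩
  ext x y
  obtain ⟨v, rfl⟩ := G.contractVertex_surjective γ x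
  obtain ⟨w, rfl⟩ := G.contractVertex_surjective γ y
  exact Setoid.ext_iff.1 h v w

/-- Given a spanning forest of `γ`, an edge set outside `γ` completes it to a spanning forest of
`G` exactly when it is a spanning forest of the contraction. -/
theorem isSpanningForest_union_iff {γ : Set G.E} (μ : Set (G.contract γ).E)
    {ν : Set (G.restrict γ).E} (hν : (G.restrict γ).IsSpanningForest ν) :
    G.IsSpanningForest (G.contractEdge γ '' μ ∪ G.restrictEdge γ '' ν) ↔
      (G.contract γ).IsSpanningForest μ := by
  obtain ⟨hν1, hν2⟩ := (G.isSpanningForest_restrict_iff γ ν).1 hν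
  have hsub := G.image_restrictEdge_subset γ ν
  have hdisj := G.disjoint_image_contractEdge γ μ
  have hconn : G.connSetoid (G.contractEdge γ '' μ ∪ G.restrictEdge γ '' ν) =
      G.connSetoid (G.contractEdge γ '' μ ∪ γ) := by
    rw [connSetoid_union, hν2, connSetoid_union]
  have hh1 : G.h1 (G.contractEdge γ '' μ ∪ G.restrictEdge γ '' ν) = (G.contract γ).h1 μ := by
    have h := G.h1_contract_add_h1 γ μ
    rw [h1_eq] at hν1 h ⊢
    rw [h1_eq, h1_eq] at h
    rw [Set.ncard_union_eq hdisj] at h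
    rw [Set.ncard_union_eq (hdisj.mono_right hsub), h0, hconn]
    rw [h0, hν2] at hν1
    rw [h1_eq]
    unfold h0 at *
    push_cast at *
    linarith
  rw [IsSpanningForest, IsSpanningForest, hh1, hconn, connSetoid_contract_eq_iff, Set.image_univ,
    range_contractEdge, Set.compl_union_self]

theorem h1_lt_ncard_diff {γ F : Set G.E} (hF : G.h1 F = 0)
    (h : ¬ (G.restrict γ).IsSpanningForest (G.restrictEdge γ ⁻¹' F)) :
    G.h1 γ < ((γ \ F).ncard : ℤ) := by
  rw [isSpanningForest_restrict_iff, Set.image_preimage_eq_inter_range, range_restrictEdge,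
    Set.inter_comm] at h
  have hac : G.h1 (γ ∩ F) = 0 :=
    le_antisymm (hF ▸ G.h1_mono Set.inter_subset_right) (G.h1_nonneg _)
  have hlt : G.h0 γ < G.h0 (γ ∩ F) := by
    by_contra! hle
    exact h ⟨hac, G.connSetoid_eq_of_subset_of_h0_le Set.inter_subset_left hle⟩
  have h2 := Set.ncard_inter_add_ncard_sdiff_eq_ncard γ F
  rw [h1_eq] at hac ⊢
  omega

theorem image_compl_union_image_compl (γ : Set G.E) (μ : Set (G.contract γ).E)
    (ν : Set (G.restrict γ).E) :
    G.contractEdge γ '' μᶜ ∪ G.restrictEdge γ '' νᶜ =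
      (G.contractEdge γ '' μ ∪ G.restrictEdge γ '' ν)ᶜ := by
  ext e
  by_cases he : e ∈ γ
  · obtain ⟨x, rfl⟩ : ∃ x, G.restrictEdge γ x = e := ⟨⟨e, he⟩, rfl⟩
    have h1 (s : Set (G.contract γ).E) : G.restrictEdge γ x ∉ G.contractEdge γ '' s :=
      fun h => Set.disjoint_left.1 (G.disjoint_image_contractEdge γ s) h he
    simp [h1, -Set.mem_image, (G.restrictEdge_injective γ).mem_set_image]
  · obtain ⟨x, rfl⟩ : ∃ x, G.contractEdge γ x = e := ⟨⟨e, he⟩, rfl⟩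
    have h1 (s : Set (G.restrict γ).E) : G.contractEdge γ x ∉ G.restrictEdge γ '' s :=
      fun h => he (G.image_restrictEdge_subset γ s h)
    simp [h1, -Set.mem_image, (G.contractEdge_injective γ).mem_set_image]

theorem kirchhoff_eq_sum : G.kirchhoff =
    ∑ F ∈ (Set.toFinite {F : Set G.E | G.IsSpanningForest F}).toFinset,
      ∏ᶠ e ∈ Fᶜ, MvPolynomial.X e :=
  finsum_mem_eq_finite_toFinset_sum _ _

theorem rename_finprod_mem_X {σ τ : Type*} [Finite σ] {f : σ → τ} (hf : Function.Injective f)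
    (s : Set σ) :
    MvPolynomial.rename f (∏ᶠ e ∈ s, MvPolynomial.X e : MvPolynomial σ ℤ) =
      ∏ᶠ e ∈ f '' s, MvPolynomial.X e := by
  rw [finprod_mem_image hf.injOn]
  let g : MvPolynomial σ ℤ →* MvPolynomial τ ℤ :=
    MonoidHomClass.toMonoidHom (MvPolynomial.rename f)
  exact (g.map_finprod_mem _ (Set.toFinite s)).trans
    (finprod_mem_congr rfl fun e _ => MvPolynomial.rename_X f e)

theorem finprod_mem_X_eq_monomial {σ : Type*} [Finite σ] (s : Set σ) :
    (∏ᶠ e ∈ s, MvPolynomial.X e : MvPolynomial σ ℤ) =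
      MvPolynomial.monomial (Finsupp.equivFunOnFinite.symm (s.indicator 1)) 1 := by
  cases nonempty_fintype σ
  rw [MvPolynomial.monomial_eq, Finsupp.prod_fintype _ _ (by simp),
    finprod_mem_eq_finite_toFinset_prod _ s.toFinite,
    ← Finset.prod_subset (Finset.subset_univ s.toFinite.toFinset)]
  · simp only [map_one, one_mul]
    refine Finset.prod_congr rfl fun e he => ?_
    have : e ∈ s := by simpa using he
    simp [this]
  · intro e _ he
    have : e ∉ s := by simpa using he
    simp [this]

/-- The product of the polynomials of the contraction and the subgraph collects those spanning
forests of `G` which restrict to a spanning forest of the subgraph. -/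
theorem rename_kirchhoff_contract_mul_restrict (γ : Set G.E) :
    MvPolynomial.rename (G.contractEdge γ) (G.contract γ).kirchhoff *
        MvPolynomial.rename (G.restrictEdge γ) (G.restrict γ).kirchhoff =
      ∑ F ∈ (Set.toFinite {F : Set G.E | G.IsSpanningForest F}).toFinset with
        (G.restrict γ).IsSpanningForest (G.restrictEdge γ ⁻¹' F),
        ∏ᶠ e ∈ Fᶜ, MvPolynomial.X e := by
  rw [kirchhoff_eq_sum, kirchhoff_eq_sum, map_sum, map_sum, Finset.sum_mul_sum,
    ← Finset.sum_product']
  have hc (μ : Set (G.contract γ).E) (ν : Set (G.restrict γ).E) :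
      G.contractEdge γ ⁻¹' (G.contractEdge γ '' μ ∪ G.restrictEdge γ '' ν) = μ := by
    rw [Set.preimage_union, Set.preimage_image_eq _ (G.contractEdge_injective γ),
      Set.union_eq_left]
    rintro e ⟨x, -, hx⟩
    exact (G.contractEdge_notMem γ e (hx ▸ G.restrictEdge_mem γ x)).elim
  have hr (μ : Set (G.contract γ).E) (ν : Set (G.restrict γ).E) :
      G.restrictEdge γ ⁻¹' (G.contractEdge γ '' μ ∪ G.restrictEdge γ '' ν) = ν := by
    rw [Set.preimage_union, Set.preimage_image_eq _ (G.restrictEdge_injective γ),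
      Set.union_eq_right]
    rintro e ⟨x, -, hx⟩
    exact (G.contractEdge_notMem γ x (hx ▸ G.restrictEdge_mem γ e)).elim
  have hu (F : Set G.E) :
      G.contractEdge γ '' (G.contractEdge γ ⁻¹' F) ∪ G.restrictEdge γ '' (G.restrictEdge γ ⁻¹' F)
        = F := by
    rw [Set.image_preimage_eq_inter_range, Set.image_preimage_eq_inter_range, range_contractEdge,
      range_restrictEdge, ← Set.inter_union_distrib_left, Set.compl_union_self, Set.inter_univ]
  refine Finset.sum_bij' (fun p _ => G.contractEdge γ '' p.1 ∪ G.restrictEdge γ '' p.2)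
    (fun F _ => (G.contractEdge γ ⁻¹' F, G.restrictEdge γ ⁻¹' F)) ?_ ?_ ?_ ?_ ?_
  · rintro ⟨μ, ν⟩ h
    simp only [Finset.mem_product, Set.Finite.mem_toFinset, Set.mem_ofPred_eq] at h
    simp only [Finset.mem_filter, Set.Finite.mem_toFinset, Set.mem_ofPred_eq, hr]
    exact ⟨(G.isSpanningForest_union_iff μ h.2).2 h.1, h.2⟩
  · intro F h
    simp only [Finset.mem_filter, Set.Finite.mem_toFinset, Set.mem_ofPred_eq] at h
    simp only [Finset.mem_product, Set.Finite.mem_toFinset, Set.mem_ofPred_eq]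
    refine ⟨(G.isSpanningForest_union_iff _ h.2).1 ?_, h.2⟩
    rw [hu]
    exact h.1
  · rintro ⟨μ, ν⟩ -
    simp only [hc, hr]
  · intro F _
    exact hu F
  · rintro ⟨μ, ν⟩ -
    have hdisj := (G.disjoint_image_contractEdge γ μᶜ).mono_right
      (G.image_restrictEdge_subset γ νᶜ)
    rw [rename_finprod_mem_X (G.contractEdge_injective γ),
      rename_finprod_mem_X (G.restrictEdge_injective γ),
      ← finprod_mem_union hdisj (Set.toFinite _) (Set.toFinite _),
      image_compl_union_image_compl]

end Multigraph

/-- `ψ(Γ) = ψ(Γ//γ)·ψ(γ) + ψ_{Γ,γ}`, where every monomial of the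
remainder `ψ_{Γ,γ} = ψ(Γ) − ψ(Γ//γ)·ψ(γ)` has degree in the variables of `γ`
strictly greater than `h1(γ)`. -/
theorem kirchhoff_contract_factorization (G : Multigraph) (hG : G.Connected)
    (hcore : G.IsCore Set.univ) (γ : Set G.E) (hγ : G.IsCore γ) :
    ∀ d ∈ (G.kirchhoff -
        MvPolynomial.rename (fun e : (G.contract γ).E => (e.1 : G.E))
            (G.contract γ).kirchhoff *
        MvPolynomial.rename (fun e : (G.restrict γ).E => (e.1 : G.E))
            (G.restrict γ).kirchhoff).support,
      G.h1 γ < ((∑ᶠ e ∈ γ, d e : ℕ) : ℤ) := by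
  intro d hd
  have hprod := G.rename_kirchhoff_contract_mul_restrict γ
  unfold Multigraph.contractEdge Multigraph.restrictEdge at hprod
  rw [hprod, G.kirchhoff_eq_sum, ← Finset.sum_filter_add_sum_filter_not _
    (fun F => (G.restrict γ).IsSpanningForest (G.restrictEdge γ ⁻¹' F))] at hd
  unfold Multigraph.restrictEdge at hd
  rw [add_sub_cancel_left] at hd
  obtain ⟨F, hF, hdF⟩ := Finset.mem_biUnion.1 (MvPolynomial.support_sum hd)
  simp only [Finset.mem_filter, Set.Finite.mem_toFinset, Set.mem_ofPred_eq] at hF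
  rw [Multigraph.finprod_mem_X_eq_monomial] at hdF
  obtain rfl := Finset.mem_singleton.1 (MvPolynomial.support_monomial_subset hdF)
  have hsum : (∑ᶠ e ∈ γ, (Finsupp.equivFunOnFinite.symm (Fᶜ.indicator 1) : G.E →₀ ℕ) e) =
      (γ \ F).ncard := by
    cases nonempty_fintype G.E
    rw [Set.sdiff_eq, finsum_mem_eq_finite_toFinset_sum _ γ.toFinite, Set.ncard_eq_toFinset_card',
      Finset.card_eq_sum_ones, ← Finset.sum_subset (s₁ := (γ ∩ Fᶜ).toFinset)]
    · refine Finset.sum_congr rfl fun e he => ?_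
      have : e ∈ Fᶜ := (Set.mem_toFinset.1 he).2
      simp [Set.indicator_of_mem this]
    · intro e he
      simpa using (Set.mem_toFinset.1 he).1
    · intro e he he'
      have : e ∉ Fᶜ := fun h => he' (Set.mem_toFinset.2 ⟨by simpa using he, h⟩)
      simp [Set.indicator_of_notMem this]
  rw [hsum]
  exact G.h1_lt_ncard_diff hF.1.1 hF.2
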